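/- (Existence of MRD codes.) Let q be a prime power, m, n ≥ 1, and 1 ≤ δ ≤ min{m,n}. Then there exists an F_q-linear subspace V of the space of m×n matrices over F_q such that every nonzero element of V has rank at least δ and dim_{F_q}(V) = max{m,n}·(min{m,n} − δ + 1). In particular, for m = n = 2t and δ = t there exists such a code containing exactly q^{2t(t+1)} matrices. -/

import Mathlib

open Module Matrix

/-- The `F`-linear endomorphism `x ↦ ∑ i, c i * x ^ (q ^ i)` of an extension `K` of the finite
field `F` with `q` elements, as a linear function of its coefficients `c`. -/
noncomputable def linearizedMap (F K : Type*) [Field F] [Fintype F] [Field K] [Algebra F K]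
    (k : ℕ) :
    (Fin k → K) →ₗ[F] K →ₗ[F] K :=
  ∑ i : Fin k, (LinearMap.lcomp F K ((FiniteField.frobeniusAlgHom F K ^ (i : ℕ)).toLinearMap)) ∘ₗ
    (LinearMap.mul F K) ∘ₗ LinearMap.proj i

theorem linearizedMap_apply (F K : Type*) [Field F] [Fintype F] [Field K] [Algebra F K] (k : ℕ)
    (c : Fin k → K) (x : K) :
    linearizedMap F K k c x = ∑ i : Fin k, c i * x ^ Fintype.card F ^ (i : ℕ) := by
  simp [linearizedMap, FiniteField.coe_frobeniusAlgHom, AlgHom.coe_pow, pow_iterate]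

/-- A nonzero linearized polynomial of `q`-degree less than `k` has a kernel of dimension less
than `k`. -/
theorem finrank_ker_linearizedMap_lt (F K : Type*) [Field F] [Fintype F] [Field K] [Algebra F K]
    [FiniteDimensional F K] (k : ℕ) {c : Fin k → K} (hc : c ≠ 0) :
    finrank F (LinearMap.ker (linearizedMap F K k c)) < k := by
  classical
  have hq : 1 < Fintype.card F := Fintype.one_lt_card
  obtain ⟨j, hj⟩ := Function.ne_iff.mp hc
  let P : Polynomial K := ∑ i : Fin k, Polynomial.monomial (Fintype.card F ^ (i : ℕ)) (c i)
  have hP : P ≠ 0 := by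
    intro h
    apply hj
    have h2 := congrArg (fun p => p.coeff (Fintype.card F ^ (j : ℕ))) h
    simpa [P, Polynomial.finsetSum_coeff, Polynomial.coeff_monomial,
      Nat.pow_right_inj hq, Fin.val_inj] using h2
  have hdeg : P.natDegree ≤ Fintype.card F ^ (k - 1) :=
    Polynomial.natDegree_sum_le_of_forall_le _ _ fun i _ =>
      (Polynomial.natDegree_monomial_le _).trans (Nat.pow_le_pow_right hq.le (by omega))
  have hsub : (LinearMap.ker (linearizedMap F K k c) : Set K) ⊆ P.roots.toFinset := by
    intro x hx
    have hx : linearizedMap F K k c x = 0 := hx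
    rw [linearizedMap_apply] at hx
    simpa [hP, P, Polynomial.eval_finsetSum, Polynomial.eval_monomial] using hx
  have hcard : Nat.card (LinearMap.ker (linearizedMap F K k c)) ≤ Fintype.card F ^ (k - 1) := by
    calc Nat.card (LinearMap.ker (linearizedMap F K k c))
        = (LinearMap.ker (linearizedMap F K k c) : Set K).ncard := rfl
      _ ≤ (P.roots.toFinset : Set K).ncard := Set.ncard_le_ncard hsub (Finset.finite_toSet _)
      _ = P.roots.toFinset.card := Set.ncard_coe_finset _
      _ ≤ P.roots.card := Multiset.toFinset_card_le _
      _ ≤ P.natDegree := P.card_roots'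
      _ ≤ _ := hdeg
  rw [Module.natCard_eq_pow_finrank (K := F), Nat.card_eq_fintype_card,
    Nat.pow_le_pow_iff_right hq] at hcard
  have := j.2
  omega

/-- The Gabidulin construction of MRD codes, for matrices with at least as many rows as columns. -/
theorem exists_mrd_code_of_le (F : Type*) [Field F] [Fintype F] {N r δ : ℕ}
    (hr : r ≤ N) (hδ1 : 1 ≤ δ) (hδ : δ ≤ r) :
    ∃ V : Submodule F (Matrix (Fin N) (Fin r) F),
      (∀ A ∈ V, A ≠ 0 → δ ≤ A.rank) ∧ finrank F V = N * (r - δ + 1) := by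
  obtain ⟨p, hp⟩ := CharP.exists F
  have : Fact p.Prime := ⟨CharP.char_is_prime F p⟩
  have : NeZero N := ⟨by omega⟩
  let K := FiniteField.Extension F p N
  have hK : finrank F K = N := FiniteField.finrank_extension F p N
  let e : K ≃ₗ[F] (Fin N → F) := LinearEquiv.ofFinrankEq _ _ (by simp [hK])
  obtain ⟨ι, hι⟩ : ∃ ι : (Fin r → F) →ₗ[F] K, Function.Injective ι :=
    finrank_le_iff_exists_linearMap.mp (by simpa [hK] using hr)
  let Φ : (Fin (r - δ + 1) → K) →ₗ[F] Matrix (Fin N) (Fin r) F :=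
    LinearMap.toMatrix'.toLinearMap ∘ₗ LinearMap.lcomp F (Fin N → F) ι ∘ₗ
      LinearMap.llcomp F K K (Fin N → F) e.toLinearMap ∘ₗ linearizedMap F K (r - δ + 1)
  have hrank (c) (hc : c ≠ 0) : δ ≤ (Φ c).rank := by
    let g : (Fin r → F) →ₗ[F] (Fin N → F) :=
      e.toLinearMap ∘ₗ linearizedMap F K (r - δ + 1) c ∘ₗ ι
    have hg : (Φ c).rank = finrank F (LinearMap.range g) := by
      rw [Matrix.rank, ← Matrix.toLin'_apply']
      change finrank F (LinearMap.range (Matrix.toLin' (LinearMap.toMatrix' g))) = _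
      rw [Matrix.toLin'_toMatrix']
    have hker : finrank F (LinearMap.ker g) ≤
        finrank F (LinearMap.ker (linearizedMap F K (r - δ + 1) c)) := by
      refine LinearMap.finrank_le_finrank_of_injective
        (f := ι.restrict (p := LinearMap.ker g) fun x hx => ?_) ?_
      · simpa [g] using hx
      · intro x y hxy
        exact Subtype.ext (hι (congrArg Subtype.val hxy))
    have hlt := finrank_ker_linearizedMap_lt F K (r - δ + 1) hc
    have hsum := LinearMap.finrank_range_add_finrank_ker g
    rw [Module.finrank_fin_fun] at hsum
    omega
  have hinj : Function.Injective Φ := by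
    refine (injective_iff_map_eq_zero Φ).mpr fun c h => ?_
    by_contra hc
    have := hrank c hc
    rw [h, Matrix.rank_zero] at this
    omega
  refine ⟨LinearMap.range Φ, ?_, ?_⟩
  · rintro _ ⟨c, rfl⟩ hA
    exact hrank c fun h => hA (by rw [h, map_zero])
  · rw [LinearMap.finrank_range_of_inj hinj, Module.finrank_pi_fintype]
    simp [hK, mul_comm]

/-- MRD codes of every shape and every admissible minimum rank distance exist over a finite field. -/
theorem exists_mrd_code (F : Type*) [Field F] [Fintype F] {m n δ : ℕ}
    (hδ1 : 1 ≤ δ) (hδ : δ ≤ min m n) :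
    ∃ V : Submodule F (Matrix (Fin m) (Fin n) F),
      (∀ A ∈ V, A ≠ 0 → δ ≤ A.rank) ∧ finrank F V = max m n * (min m n - δ + 1) := by
  rcases le_total n m with h | h
  · rw [min_eq_right h] at hδ ⊢
    rw [max_eq_left h]
    exact exists_mrd_code_of_le F h hδ1 hδ
  · rw [min_eq_left h] at hδ ⊢
    rw [max_eq_right h]
    obtain ⟨V, hV, hdim⟩ := exists_mrd_code_of_le F h hδ1 hδ
    let T := Matrix.transposeLinearEquiv (Fin n) (Fin m) F F
    refine ⟨V.map T.toLinearMap, ?_, (LinearEquiv.finrank_map_eq T V).trans hdim⟩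
    rintro _ ⟨A, hA, rfl⟩ hne
    change δ ≤ Aᵀ.rank
    rw [Matrix.rank_transpose]
    exact hV A hA fun h0 => hne (by rw [h0, map_zero])

/-- Existence of MRD codes.  Let `q` be a prime power (realized as the cardinality of
a finite field `F`), `m, n ≥ 1`, and `1 ≤ δ ≤ min{m,n}`.  Then there exists an
`F_q`-linear subspace `V` of the `m×n` matrices over `F_q` such that every nonzero
element of `V` has rank at least `δ` and `dim_{F_q}(V) = max{m,n}·(min{m,n} − δ + 1)`.
In particular, for `m = n = 2t` and `δ = t` there exists such a code containing
exactly `q^{2t(t+1)}` matrices. -/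
theorem mrd_codes_exist
    (F : Type*) [Field F] [Fintype F] (m n δ : ℕ)
    (hm : 1 ≤ m) (hn : 1 ≤ n) (hδ1 : 1 ≤ δ) (hδ : δ ≤ min m n) :
    (∃ V : Submodule F (Matrix (Fin m) (Fin n) F),
      (∀ A ∈ V, A ≠ 0 → δ ≤ A.rank) ∧
      Module.finrank F ↥V = max m n * (min m n - δ + 1)) ∧
    (∀ t : ℕ, 1 ≤ t →
      ∃ V : Submodule F (Matrix (Fin (2 * t)) (Fin (2 * t)) F),
        (∀ A ∈ V, A ≠ 0 → t ≤ A.rank) ∧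
        Nat.card ↥V = Fintype.card F ^ (2 * t * (t + 1))) := by
  refine ⟨exists_mrd_code F hδ1 hδ, fun t ht => ?_⟩
  obtain ⟨V, hV, hdim⟩ := exists_mrd_code F (m := 2 * t) (n := 2 * t) ht (by omega)
  refine ⟨V, hV, ?_⟩
  rw [Module.natCard_eq_pow_finrank (K := F), hdim, Nat.card_eq_fintype_card, max_self, min_self,
    show 2 * t - t = t by omega]
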